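/- arXiv:1901.02536 — 2 statements merged into one kernel-verified Lean document; each statement's English description precedes it below -/
import Mathlib

section
/- Let G be a finite group and S a nonempty subset of G. Then there exists a subset T ⊆ G with |T| ≤ (|G|/|S|)·ln|G| + 1 such that the right translates of S by elements of T cover G, i.e., G = ⋃_{g ∈ T} S·g, where S·g = {s·g : s ∈ S}. -/
/-- By averaging, some right translate of `S` covers a proportion at least `|S|/|G|` of `U`. -/
theorem exists_translate_card_uncovered_le {G : Type*} [Group G] [Fintype G] [DecidableEq G]
    (S U : Finset G) :
    ∃ t : G, ((U.filter fun g => g * t⁻¹ ∉ S).card : ℝ) ≤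
      (1 - (S.card : ℝ) / Fintype.card G) * U.card := by
  have hn : (0 : ℝ) < Fintype.card G := by exact_mod_cast Fintype.card_pos
  have hsum : ∑ t : G, (U.filter fun g => g * t⁻¹ ∈ S).card = U.card * S.card := by
    have hcard (g : G) : (Finset.univ.filter fun t : G => g * t⁻¹ ∈ S).card = S.card := by
      refine Finset.card_bij' (fun t _ => g * t⁻¹) (fun s _ => s⁻¹ * g) ?_ ?_ ?_ ?_ <;>
        simp [mul_assoc]
    have h := Finset.sum_card_bipartiteAbove_eq_sum_card_bipartiteBelow
      (s := (Finset.univ : Finset G)) (t := U) (fun t g => g * t⁻¹ ∈ S)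
    simp only [Finset.bipartiteAbove, Finset.bipartiteBelow, hcard, Finset.sum_const,
      smul_eq_mul] at h
    exact h
  obtain ⟨t, -, ht⟩ := Finset.exists_le_of_sum_le (s := (Finset.univ : Finset G))
    (f := fun _ => (U.card : ℝ) * S.card / Fintype.card G)
    (g := fun t => ((U.filter fun g => g * t⁻¹ ∈ S).card : ℝ)) Finset.univ_nonempty (by
      rw [← Nat.cast_sum, hsum]
      simp only [Finset.sum_const, Finset.card_univ, nsmul_eq_mul]
      push_cast
      exact (mul_div_cancel₀ _ hn.ne').le)
  refine ⟨t, ?_⟩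
  have hsplit : ((U.filter fun g => g * t⁻¹ ∈ S).card : ℝ) +
      (U.filter fun g => g * t⁻¹ ∉ S).card = U.card := by
    exact_mod_cast Finset.card_filter_add_card_filter_not (s := U) (fun g => g * t⁻¹ ∈ S)
  have hmul : (1 - (S.card : ℝ) / Fintype.card G) * U.card =
      U.card - (U.card : ℝ) * S.card / Fintype.card G := by ring
  linarith

/-- Choosing translates greedily, `k` of them leave at most `|G| (1 - |S|/|G|)^k` elements
uncovered. -/
theorem exists_translates_card_uncovered_le {G : Type*} [Group G] [Fintype G] [DecidableEq G]
    (S : Finset G) (k : ℕ) :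
    ∃ T : Finset G, T.card ≤ k ∧
      ((Finset.univ.filter fun g : G => ∀ t ∈ T, g * t⁻¹ ∉ S).card : ℝ) ≤
        (1 - (S.card : ℝ) / Fintype.card G) ^ k * Fintype.card G := by
  induction k with
  | zero => exact ⟨∅, by simp⟩
  | succ k ih =>
    obtain ⟨T, hT, hU⟩ := ih
    obtain ⟨t, ht⟩ := exists_translate_card_uncovered_le S
      (Finset.univ.filter fun g : G => ∀ t ∈ T, g * t⁻¹ ∉ S)
    refine ⟨insert t T, (Finset.card_insert_le _ _).trans (by lia), ?_⟩
    have hle : (0 : ℝ) ≤ 1 - (S.card : ℝ) / Fintype.card G :=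
      sub_nonneg.2 (div_le_one_of_le₀ (by exact_mod_cast S.card_le_univ) (by positivity))
    have hset : (Finset.univ.filter fun g : G => ∀ u ∈ insert t T, g * u⁻¹ ∉ S) =
        (Finset.univ.filter fun g : G => ∀ u ∈ T, g * u⁻¹ ∉ S).filter
          fun g => g * t⁻¹ ∉ S := by
      ext g
      simp [and_comm]
    rw [hset, pow_succ', mul_assoc]
    exact ht.trans (mul_le_mul_of_nonneg_left hU hle)

/-- **Covering by translates.** For a finite group `G` and a nonempty subset `S ⊆ G`,
there is a set `T ⊆ G` of at most `(|G|/|S|)·ln|G| + 1` elements whose right translates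
of `S` cover `G`: every `g ∈ G` can be written `g = s·t` with `s ∈ S`, `t ∈ T`. -/
theorem cover_by_translates {G : Type*} [Group G] [Fintype G] [DecidableEq G]
    (S : Finset G) (hS : S.Nonempty) :
    ∃ T : Finset G,
      (T.card : ℝ) ≤ (Fintype.card G : ℝ) / (S.card : ℝ) * Real.log (Fintype.card G) + 1 ∧
      ∀ g : G, ∃ t ∈ T, ∃ s ∈ S, g = s * t := by
  have hn : (0 : ℝ) < Fintype.card G := by exact_mod_cast Fintype.card_pos
  have hs : (0 : ℝ) < S.card := by exact_mod_cast hS.card_pos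
  have hlog : 0 ≤ Real.log (Fintype.card G) := Real.log_natCast_nonneg _
  set x : ℝ := (Fintype.card G : ℝ) / (S.card : ℝ) * Real.log (Fintype.card G) with hx
  obtain ⟨T, hT, hU⟩ := exists_translates_card_uncovered_le S (⌊x⌋₊ + 1)
  refine ⟨T, ?_, ?_⟩
  · have hfloor : (⌊x⌋₊ : ℝ) ≤ x := Nat.floor_le (by positivity)
    have hcast : (T.card : ℝ) ≤ (⌊x⌋₊ : ℝ) + 1 := by exact_mod_cast hT
    linarith
  have hle : (0 : ℝ) ≤ 1 - (S.card : ℝ) / Fintype.card G :=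
    sub_nonneg.2 (div_le_one_of_le₀ (by exact_mod_cast S.card_le_univ) (by positivity))
  have hlt : (1 - (S.card : ℝ) / Fintype.card G) ^ (⌊x⌋₊ + 1) * Fintype.card G < 1 := by
    have hexp : Real.log (Fintype.card G) <
        ((⌊x⌋₊ + 1 : ℕ) : ℝ) * ((S.card : ℝ) / Fintype.card G) := by
      have hxlt : x < ((⌊x⌋₊ + 1 : ℕ) : ℝ) := by exact_mod_cast Nat.lt_floor_add_one x
      calc Real.log (Fintype.card G) = x * ((S.card : ℝ) / Fintype.card G) := by
            rw [hx]; field_simp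
        _ < _ := mul_lt_mul_of_pos_right hxlt (by positivity)
    calc (1 - (S.card : ℝ) / Fintype.card G) ^ (⌊x⌋₊ + 1) * Fintype.card G
        ≤ Real.exp (-((S.card : ℝ) / Fintype.card G)) ^ (⌊x⌋₊ + 1) * Fintype.card G := by
          gcongr
          exact Real.one_sub_le_exp_neg _
      _ = Real.exp (Real.log (Fintype.card G) -
            ((⌊x⌋₊ + 1 : ℕ) : ℝ) * ((S.card : ℝ) / Fintype.card G)) := by
          rw [← Real.exp_nat_mul, sub_eq_neg_add, Real.exp_add, Real.exp_log hn, mul_neg]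
      _ < 1 := Real.exp_lt_one_iff.2 (by linarith)
  have hzero : (Finset.univ.filter fun g : G => ∀ t ∈ T, g * t⁻¹ ∉ S).card = 0 :=
    Nat.lt_one_iff.1 (by exact_mod_cast hU.trans_lt hlt)
  intro g
  by_contra! h
  refine Finset.notMem_empty g (Finset.card_eq_zero.1 hzero ▸ ?_)
  exact Finset.mem_filter.2 ⟨Finset.mem_univ _, fun t ht hg => h t ht _ hg (by simp)⟩
end

section
/- Let H be a finite group and N a normal subgroup of H. Let e, t, d be positive integers and let λ₁, …, λ_t : N → GL_d(ℂ) be pairwise non-isomorphic irreducible matrix representations of N, all of dimension d. Let σ : H → GL_{etd}(ℂ) be a matrix representation such that for every n ∈ N, σ(n) = I_e ⊗ (λ₁(n) ⊕ λ₂(n) ⊕ ⋯ ⊕ λ_t(n)), where ⊕ denotes the block-diagonal direct sum. Let J be the d × td matrix (I_d | I_d | ⋯ | I_d) consisting of t horizontally concatenated copies of the d × d identity matrix. Then for every matrix M ∈ ℂ^{etd × etd} there exist matrices M_n ∈ ℂ^{et × e}, one for each n ∈ N, such that ∑_{n ∈ N} (M_n ⊗ J) · σ(n) = M. -/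
open Matrix Kronecker

section SchurOrthogonality

variable {G : Type*} [Group G] {d : ℕ}

/-- A singular matrix intertwining a representation `ρ` with an irreducible one vanishes. -/
theorem intertwiner_eq_zero_of_not_isUnit {ρ τ : G →* GL (Fin d) ℂ}
    (hτ : ∀ U : Submodule ℂ (Fin d → ℂ),
      (∀ g : G, U.map (Matrix.toLin' (τ g : Matrix (Fin d) (Fin d) ℂ)) ≤ U) → U = ⊥ ∨ U = ⊤)
    {P : Matrix (Fin d) (Fin d) ℂ}
    (hP : ∀ g, (ρ g : Matrix (Fin d) (Fin d) ℂ) * P = P * (τ g : Matrix (Fin d) (Fin d) ℂ))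
    (hu : ¬ IsUnit P) : P = 0 := by
  have hinv : ∀ g : G, (LinearMap.ker (Matrix.toLin' P)).map
      (Matrix.toLin' (τ g : Matrix (Fin d) (Fin d) ℂ)) ≤ LinearMap.ker (Matrix.toLin' P) := by
    rintro g _ ⟨x, hx, rfl⟩
    simp only [SetLike.mem_coe, LinearMap.mem_ker, Matrix.toLin'_apply] at hx ⊢
    rw [Matrix.mulVec_mulVec, ← hP, ← Matrix.mulVec_mulVec, hx, Matrix.mulVec_zero]
  rcases hτ _ hinv with h | h
  · refine absurd (Matrix.mulVec_injective_iff_isUnit.mp ?_) hu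
    exact LinearMap.ker_eq_bot.mp h
  · exact Matrix.toLin'.map_eq_zero_iff.mp (LinearMap.ker_eq_top.mp h)

/-- **Schur's lemma**: a matrix commuting with an irreducible representation is scalar. -/
theorem exists_eq_smul_one_of_commute {ρ : G →* GL (Fin d) ℂ} (hd : 0 < d)
    (hρ : ∀ U : Submodule ℂ (Fin d → ℂ),
      (∀ g : G, U.map (Matrix.toLin' (ρ g : Matrix (Fin d) (Fin d) ℂ)) ≤ U) → U = ⊥ ∨ U = ⊤)
    {P : Matrix (Fin d) (Fin d) ℂ}
    (hP : ∀ g, (ρ g : Matrix (Fin d) (Fin d) ℂ) * P = P * (ρ g : Matrix (Fin d) (Fin d) ℂ)) :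
    ∃ μ : ℂ, P = μ • 1 := by
  have : Nonempty (Fin d) := ⟨⟨0, hd⟩⟩
  obtain ⟨μ, hμ⟩ := spectrum.nonempty_of_isAlgClosed_of_finiteDimensional ℂ P
  refine ⟨μ, ?_⟩
  have h := intertwiner_eq_zero_of_not_isUnit (ρ := ρ) (P := algebraMap ℂ _ μ - P) hρ
    (fun g => by rw [mul_sub, sub_mul, hP, Algebra.commutes]) hμ
  rw [← sub_eq_zero.mp h, Algebra.algebraMap_eq_smul_one]

variable [Fintype G]

/-- The average `∑ g, ρ g * B * τ g⁻¹` intertwines `ρ` and `τ`. -/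
theorem mul_sum_conj_eq_sum_conj_mul (ρ τ : G →* GL (Fin d) ℂ) (B : Matrix (Fin d) (Fin d) ℂ)
    (h : G) :
    (ρ h : Matrix (Fin d) (Fin d) ℂ) *
        ∑ g, (ρ g : Matrix (Fin d) (Fin d) ℂ) * B * (τ g⁻¹ : Matrix (Fin d) (Fin d) ℂ) =
      (∑ g, (ρ g : Matrix (Fin d) (Fin d) ℂ) * B * (τ g⁻¹ : Matrix (Fin d) (Fin d) ℂ)) *
        (τ h : Matrix (Fin d) (Fin d) ℂ) := by
  rw [Finset.mul_sum, Finset.sum_mul]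
  refine Fintype.sum_equiv (Equiv.mulLeft h) _ _ fun g => ?_
  have hτ : (τ (h * g)⁻¹ : Matrix (Fin d) (Fin d) ℂ) * (τ h : Matrix (Fin d) (Fin d) ℂ) =
      (τ g⁻¹ : Matrix (Fin d) (Fin d) ℂ) := by
    rw [← Units.val_mul, ← map_mul]
    congr 2
    group
  rw [Equiv.coe_mulLeft, mul_assoc _ _ (τ h : Matrix (Fin d) (Fin d) ℂ), hτ, map_mul,
    Units.val_mul]
  simp only [mul_assoc]

theorem sum_conj_eq_zero {ρ τ : G →* GL (Fin d) ℂ}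
    (hτ : ∀ U : Submodule ℂ (Fin d → ℂ),
      (∀ g : G, U.map (Matrix.toLin' (τ g : Matrix (Fin d) (Fin d) ℂ)) ≤ U) → U = ⊥ ∨ U = ⊤)
    (hne : ¬ ∃ T : GL (Fin d) ℂ, ∀ g : G,
      (ρ g : Matrix (Fin d) (Fin d) ℂ) =
        (T : Matrix (Fin d) (Fin d) ℂ) * (τ g : Matrix (Fin d) (Fin d) ℂ) *
          ((T⁻¹ : GL (Fin d) ℂ) : Matrix (Fin d) (Fin d) ℂ))
    (B : Matrix (Fin d) (Fin d) ℂ) :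
    ∑ g, (ρ g : Matrix (Fin d) (Fin d) ℂ) * B * (τ g⁻¹ : Matrix (Fin d) (Fin d) ℂ) = 0 := by
  have hP := mul_sum_conj_eq_sum_conj_mul ρ τ B
  refine intertwiner_eq_zero_of_not_isUnit hτ hP ?_
  rintro ⟨T, hT⟩
  refine hne ⟨T, fun g => ?_⟩
  rw [Units.eq_mul_inv_iff_mul_eq, hT]
  exact hP g

theorem sum_conj_eq_smul_one {ρ : G →* GL (Fin d) ℂ} (hd : 0 < d)
    (hρ : ∀ U : Submodule ℂ (Fin d → ℂ),
      (∀ g : G, U.map (Matrix.toLin' (ρ g : Matrix (Fin d) (Fin d) ℂ)) ≤ U) → U = ⊥ ∨ U = ⊤)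
    (B : Matrix (Fin d) (Fin d) ℂ) :
    ∑ g, (ρ g : Matrix (Fin d) (Fin d) ℂ) * B * (ρ g⁻¹ : Matrix (Fin d) (Fin d) ℂ) =
      ((Fintype.card G : ℂ) * B.trace / d) • 1 := by
  obtain ⟨μ, hμ⟩ := exists_eq_smul_one_of_commute hd hρ (mul_sum_conj_eq_sum_conj_mul ρ ρ B)
  have hconj : ∀ g : G, ((ρ g : Matrix (Fin d) (Fin d) ℂ) * B *
      (ρ g⁻¹ : Matrix (Fin d) (Fin d) ℂ)).trace = B.trace := fun g => by
    rw [Matrix.trace_mul_cycle, ← Units.val_mul, ← map_mul]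
    simp
  have htr := congrArg Matrix.trace hμ
  simp only [Matrix.trace_sum, hconj, Matrix.trace_smul, Matrix.trace_one, Finset.sum_const,
    Finset.card_univ, nsmul_eq_mul, smul_eq_mul, Fintype.card_fin] at htr
  have hd' : (d : ℂ) ≠ 0 := Nat.cast_ne_zero.mpr hd.ne'
  rw [hμ, htr, mul_div_cancel_right₀ _ hd']

/-- **Schur orthogonality** for the matrix coefficients of pairwise non-isomorphic irreducible
matrix representations. -/
theorem sum_coeff_mul_coeff_inv {ι : Type*} [DecidableEq ι] (hd : 0 < d)
    (ρ : ι → G →* GL (Fin d) ℂ)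
    (hirr : ∀ i, ∀ U : Submodule ℂ (Fin d → ℂ),
      (∀ g : G, U.map (Matrix.toLin' (ρ i g : Matrix (Fin d) (Fin d) ℂ)) ≤ U) → U = ⊥ ∨ U = ⊤)
    (hdist : ∀ i j, i ≠ j → ¬ ∃ T : GL (Fin d) ℂ, ∀ g : G,
      (ρ i g : Matrix (Fin d) (Fin d) ℂ) =
        (T : Matrix (Fin d) (Fin d) ℂ) * (ρ j g : Matrix (Fin d) (Fin d) ℂ) *
          ((T⁻¹ : GL (Fin d) ℂ) : Matrix (Fin d) (Fin d) ℂ))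
    (i j : ι) (r c l k : Fin d) :
    ∑ g, (ρ i g : Matrix (Fin d) (Fin d) ℂ) r c * (ρ j g⁻¹ : Matrix (Fin d) (Fin d) ℂ) l k =
      if i = j ∧ c = l ∧ r = k then (Fintype.card G : ℂ) / d else 0 := by
  have hentry : ∑ g, (ρ i g : Matrix (Fin d) (Fin d) ℂ) r c *
        (ρ j g⁻¹ : Matrix (Fin d) (Fin d) ℂ) l k =
      (∑ g, (ρ i g : Matrix (Fin d) (Fin d) ℂ) * Matrix.single c l 1 *
        (ρ j g⁻¹ : Matrix (Fin d) (Fin d) ℂ) : Matrix (Fin d) (Fin d) ℂ) r k := by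
    rw [Matrix.sum_apply]
    refine Finset.sum_congr rfl fun g _ => ?_
    simp [Matrix.mul_apply, Matrix.single_apply, ite_and]
  rw [hentry]
  by_cases hij : i = j
  · subst hij
    rw [sum_conj_eq_smul_one hd (hirr i)]
    by_cases hcl : c = l
    · subst hcl
      simp [Matrix.one_apply]
    · simp [hcl]
  · rw [sum_conj_eq_zero (hirr j) (hdist i j hij)]
    simp [hij]

/-- **Burnside's theorem** for several representations: any family of matrices is the
simultaneous image of one element of the group algebra. -/
theorem exists_sum_coeff_eq {ι : Type*} [Fintype ι] [DecidableEq ι] (hd : 0 < d)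
    (ρ : ι → G →* GL (Fin d) ℂ)
    (hirr : ∀ i, ∀ U : Submodule ℂ (Fin d → ℂ),
      (∀ g : G, U.map (Matrix.toLin' (ρ i g : Matrix (Fin d) (Fin d) ℂ)) ≤ U) → U = ⊥ ∨ U = ⊤)
    (hdist : ∀ i j, i ≠ j → ¬ ∃ T : GL (Fin d) ℂ, ∀ g : G,
      (ρ i g : Matrix (Fin d) (Fin d) ℂ) =
        (T : Matrix (Fin d) (Fin d) ℂ) * (ρ j g : Matrix (Fin d) (Fin d) ℂ) *
          ((T⁻¹ : GL (Fin d) ℂ) : Matrix (Fin d) (Fin d) ℂ))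
    (B : ι → Matrix (Fin d) (Fin d) ℂ) :
    ∃ a : G → ℂ, ∀ i r c, ∑ g, a g * (ρ i g : Matrix (Fin d) (Fin d) ℂ) r c = B i r c := by
  have hd' : (d : ℂ) ≠ 0 := Nat.cast_ne_zero.mpr hd.ne'
  have hG : (Fintype.card G : ℂ) ≠ 0 := Nat.cast_ne_zero.mpr Fintype.card_ne_zero
  refine ⟨fun g => ∑ j, ∑ k, ∑ l, (d / Fintype.card G : ℂ) * B j k l *
    (ρ j g⁻¹ : Matrix (Fin d) (Fin d) ℂ) l k, fun i r c => ?_⟩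
  calc
    _ = ∑ j, ∑ k, ∑ l, (d / Fintype.card G : ℂ) * B j k l *
        ∑ g, (ρ i g : Matrix (Fin d) (Fin d) ℂ) r c *
          (ρ j g⁻¹ : Matrix (Fin d) (Fin d) ℂ) l k := by
      simp only [Finset.sum_mul, Finset.mul_sum]
      rw [Finset.sum_comm]
      refine Finset.sum_congr rfl fun j _ => ?_
      rw [Finset.sum_comm]
      refine Finset.sum_congr rfl fun k _ => ?_
      rw [Finset.sum_comm]
      refine Finset.sum_congr rfl fun l _ => Finset.sum_congr rfl fun g _ => ?_
      ring
    _ = (d / Fintype.card G : ℂ) * B i r c * (Fintype.card G / d) := by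
      simp only [sum_coeff_mul_coeff_inv hd ρ hirr hdist]
      simp [ite_and]
    _ = B i r c := by field_simp

end SchurOrthogonality

/-- **Theorem 7 (sparse rewriting of a block, matrix form).** Let `N ⊴ H`, let
`λ₁, …, λ_t : N → GL_d(ℂ)` be pairwise non-isomorphic irreducible matrix representations
of `N` of dimension `d`, and let `σ : H → GL_{etd}(ℂ)` satisfy
`σ(n) = I_e ⊗ (λ₁(n) ⊕ ⋯ ⊕ λ_t(n))` for all `n ∈ N`.  With
`J = (I_d | ⋯ | I_d)` (`t` copies), every `M ∈ ℂ^{etd × etd}` can be written as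
`∑_{n ∈ N} (M_n ⊗ J) · σ(n)` for some matrices `M_n ∈ ℂ^{et × e}`. -/
theorem sparse_block_decomposition {H : Type*} [Group H] [Fintype H] (N : Subgroup H) [N.Normal]
    [Fintype N] (e t d : ℕ) (he : 0 < e) (ht : 0 < t) (hd : 0 < d)
    (lam : Fin t → (N : Subgroup H) →* GL (Fin d) ℂ)
    (hirr : ∀ i : Fin t, ∀ U : Submodule ℂ (Fin d → ℂ),
      (∀ n : N, U.map (Matrix.toLin' (lam i n : Matrix (Fin d) (Fin d) ℂ)) ≤ U) →
      U = ⊥ ∨ U = ⊤)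
    (hdist : ∀ i j : Fin t, i ≠ j →
      ¬ ∃ T : GL (Fin d) ℂ, ∀ n : N,
        (lam i n : Matrix (Fin d) (Fin d) ℂ) =
          (T : Matrix (Fin d) (Fin d) ℂ) * (lam j n : Matrix (Fin d) (Fin d) ℂ) *
            ((T⁻¹ : GL (Fin d) ℂ) : Matrix (Fin d) (Fin d) ℂ))
    (σ : H →* GL (Fin e × Fin d × Fin t) ℂ)
    (hσ : ∀ n : N, (σ (n : H) : Matrix (Fin e × Fin d × Fin t) (Fin e × Fin d × Fin t) ℂ) =
      (1 : Matrix (Fin e) (Fin e) ℂ) ⊗ₖ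
        Matrix.blockDiagonal (fun i : Fin t => (lam i n : Matrix (Fin d) (Fin d) ℂ)))
    (M : Matrix ((Fin e × Fin t) × Fin d) (Fin e × Fin d × Fin t) ℂ) :
    ∃ Mn : N → Matrix (Fin e × Fin t) (Fin e) ℂ,
      ∑ n : N,
        (Mn n ⊗ₖ (Matrix.of fun (r : Fin d) (p : Fin d × Fin t) =>
            if r = p.1 then (1 : ℂ) else 0)) *
          (σ (n : H) : Matrix (Fin e × Fin d × Fin t) (Fin e × Fin d × Fin t) ℂ) = M := by
  choose a ha using fun (p : Fin e × Fin t) (b : Fin e) =>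
    exists_sum_coeff_eq hd lam hirr hdist fun i => Matrix.of fun r c => M (p, r) (b, c, i)
  refine ⟨fun n => Matrix.of fun p b => a p b n, ?_⟩
  ext ⟨p, r⟩ ⟨b, c, i⟩
  rw [Matrix.sum_apply]
  refine Eq.trans (Finset.sum_congr rfl fun n _ => ?_) (ha p b i r c)
  rw [hσ, ← Matrix.mul_kronecker_mul, Matrix.mul_one, Matrix.kroneckerMap_apply]
  refine congrArg (a p b n * ·) ?_
  simp [Matrix.mul_apply, Fintype.sum_prod_type, Matrix.blockDiagonal_apply]
end
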